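/- Assume Case 3, and let ŝ denote the changed trajectory. Then: (1) for every t ≥ 98 and every j with 178 ≤ j ≤ 288, ŝ_(t+2262,j) = ŝ_(t,j) + Σ_{m=0}^{25} b_{t+31-j+3m}; (2) for every t ≥ 98 and every j with 94 ≤ j ≤ 288, ŝ_(t+4524,j) = ŝ_(t,j) (coordinates 94 through 288 of the changed trajectory have period 4524 from time 98 on). -/

import Mathlib

/-- A Trivium state: we use coordinates 1,…,288 of a function `ℕ → ZMod 2`. -/
abbrev TState := ℕ → ZMod 2

/-- The Trivium state-renewal map `T`. -/
def trivT (s : TState) : TState := fun j =>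
  if j = 1 then s 243 + s 286 * s 287 + s 288 + s 69
  else if j ≤ 93 then s (j - 1)
  else if j = 94 then s 66 + s 91 * s 92 + s 93 + s 171
  else if j ≤ 177 then s (j - 1)
  else if j = 178 then s 162 + s 175 * s 176 + s 177 + s 264
  else if j ≤ 288 then s (j - 1)
  else 0

/-- `Z_F`: set every coordinate with index in `F` to zero. -/
def zapF (F : Finset ℕ) (s : TState) : TState := fun j => if j ∈ F then 0 else s j

/-- The loading state `L(k, IV)`: positions 1–93 are `(k_1,…,k_80,0,…,0)`,
positions 94–177 are `(IV_1,…,IV_80,0,0,0,0)`, positions 178–288 are `(0,…,0,1,1,1)`. -/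
def loadIV (k IV : TState) : TState := fun j =>
  if j = 0 then 0
  else if j ≤ 80 then k j
  else if j ≤ 93 then 0
  else if j ≤ 173 then IV (j - 93)
  else if j ≤ 285 then 0
  else if j ≤ 288 then 1
  else 0

/-- The fault-injected trajectory with initial vector `IV`:
`s^(0) = Z_F(L(k,IV))`, `s^(t+1) = Z_F(T(s^(t)))`. -/
def trajIV (F : Finset ℕ) (k IV : TState) : ℕ → TState
  | 0 => zapF F (loadIV k IV)
  | t + 1 => zapF F (trivT (trajIV F k IV t))

/-- The fault-injected trajectory with `IV = 0`. -/
def traj (F : Finset ℕ) (k : TState) : ℕ → TState := trajIV F k (fun _ => 0)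

/-- The key-stream with initial vector `IV`. -/
def ksIV (F : Finset ℕ) (k IV : TState) (m : ℕ) : ZMod 2 :=
  trajIV F k IV (m + 1152) 66 + trajIV F k IV (m + 1152) 93 + trajIV F k IV (m + 1152) 162 +
    trajIV F k IV (m + 1152) 177 + trajIV F k IV (m + 1152) 243 + trajIV F k IV (m + 1152) 288

/-- The key-stream with `IV = 0`. -/
def ks (F : Finset ℕ) (k : TState) : ℕ → ZMod 2 := ksIV F k (fun _ => 0)

/-- `e_j` for `1 ≤ j ≤ 69`: `e_j = k_j` for `j ≤ 66`, `e_67 = k_67+1`, `e_68 = k_68+1`,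
`e_69 = k_69`. -/
def ebase (k : TState) : ℕ → ZMod 2 := fun j =>
  if j ≤ 66 then k j else if j = 67 then k 67 + 1 else if j = 68 then k 68 + 1 else k 69

/-- `e` extended to all integer indices periodically with period 69. -/
def eper (k : TState) (i : ℤ) : ZMod 2 := ebase k (((i - 1).emod 69).toNat + 1)

/-- `a_n = s_(n-1,66) + s_(n-1,91)·s_(n-1,92) + s_(n-1,93)` for a natural number `n`. -/
def aAt (F : Finset ℕ) (k : TState) (n : ℕ) : ZMod 2 :=
  traj F k (n - 1) 66 + traj F k (n - 1) 91 * traj F k (n - 1) 92 + traj F k (n - 1) 93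

/-- The sequence `a_i` for integer `i`: `a_{t+1} = s_(t,66)+s_(t,91)s_(t,92)+s_(t,93)` for
`t ≥ 27`, and for `i ≤ 27`, `a_i = a_j` where `28 ≤ j ≤ 96` and `j ≡ i (mod 69)`. -/
def aFun (F : Finset ℕ) (k : TState) (i : ℤ) : ZMod 2 :=
  if 28 ≤ i then aAt F k i.toNat else aAt F k (28 + (i - 28).emod 69).toNat

/-- `b_n = s_(n-1,162) + s_(n-1,175)·s_(n-1,176) + s_(n-1,177)` for a natural number `n`. -/
def bAt (F : Finset ℕ) (k : TState) (n : ℕ) : ZMod 2 :=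
  traj F k (n - 1) 162 + traj F k (n - 1) 175 * traj F k (n - 1) 176 + traj F k (n - 1) 177

/-- The sequence `b_i` for integer `i`: `b_{t+1} = s_(t,162)+s_(t,175)s_(t,176)+s_(t,177)` for
`t ≥ 98`, and for `i ≤ 98`, `b_i = b_j` where `99 ≤ j ≤ 176` and `j ≡ i (mod 78)`. -/
def bFun (F : Finset ℕ) (k : TState) (i : ℤ) : ZMod 2 :=
  if 99 ≤ i then bAt F k i.toNat else bAt F k (99 + (i - 99).emod 78).toNat

/-- The changed state at time 27 (Case 2, Lemma 6): coordinates 172–177 are replaced by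
`s_(27,94)+a_27, …, s_(27,99)+a_22`; all other coordinates agree with `s^(27)`. -/
def sTildeBase (F : Finset ℕ) (k : TState) : TState := fun j =>
  if 172 ≤ j ∧ j ≤ 177 then traj F k 27 (j - 78) + aFun F k (199 - (j : ℤ))
  else traj F k 27 j

/-- The changed trajectory `s̃`: `s̃^(27)` is the changed state, and
`s̃^(t+1) = Z_F(T(s̃^(t)))` for `t ≥ 27`. (For `t ≤ 27`, `sTilde F k t = s̃^(27)`.) -/
def sTilde (F : Finset ℕ) (k : TState) (t : ℕ) : TState :=
  (fun s => zapF F (trivT s))^[t - 27] (sTildeBase F k)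

/-- The changed state at time 98 (Case 3, Lemma 11): coordinates 265–288 are replaced by
`s_(98,178)+b_98, …, s_(98,201)+b_75`; all other coordinates agree with `s^(98)`. -/
def sHatBase (F : Finset ℕ) (k : TState) : TState := fun j =>
  if 265 ≤ j ∧ j ≤ 288 then traj F k 98 (j - 87) + bFun F k (363 - (j : ℤ))
  else traj F k 98 j

/-- The changed trajectory `ŝ`: `ŝ^(98)` is the changed state, and
`ŝ^(t+1) = Z_F(T(ŝ^(t)))` for `t ≥ 98`. (For `t ≤ 98`, `sHat F k t = ŝ^(98)`.) -/
def sHat (F : Finset ℕ) (k : TState) (t : ℕ) : TState :=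
  (fun s => zapF F (trivT s))^[t - 98] (sHatBase F k)

/-- `aSeq t = a_{t+1} = s_(t,66) + s_(t,91)·s_(t,92) + s_(t,93)` for `t ≥ 0`. -/
def aSeq (F : Finset ℕ) (k : TState) (t : ℕ) : ZMod 2 :=
  traj F k t 66 + traj F k t 91 * traj F k t 92 + traj F k t 93

section FaultedOrbit

variable {F : Finset ℕ}

theorem zapF_trivT_shift (hsub : F ⊆ Finset.Icc 1 93) (s : TState) {j : ℕ} (h1 : 94 ≤ j)
    (h2 : j < 288) (h3 : j ≠ 177) : zapF F (trivT s) (j + 1) = s j := by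
  have hj : j + 1 ∉ F := fun h => by
    have := Finset.mem_Icc.1 (hsub h)
    omega
  simp only [zapF, if_neg hj, trivT]
  rw [if_neg (by omega), if_neg (by omega), if_neg (by omega)]
  by_cases h : j + 1 ≤ 177
  · rw [if_pos h, Nat.add_sub_cancel]
  · rw [if_neg h, if_neg (by omega), if_pos (by omega), Nat.add_sub_cancel]

theorem zapF_trivT_94 (hsub : F ⊆ Finset.Icc 1 93) (s : TState) :
    zapF F (trivT s) 94 = s 66 + s 91 * s 92 + s 93 + s 171 := by
  have hj : 94 ∉ F := fun h => by
    have := Finset.mem_Icc.1 (hsub h)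
    omega
  simp [zapF, hj, trivT]

theorem zapF_trivT_178 (hsub : F ⊆ Finset.Icc 1 93) (s : TState) :
    zapF F (trivT s) 178 = s 162 + s 175 * s 176 + s 177 + s 264 := by
  have hj : 178 ∉ F := fun h => by
    have := Finset.mem_Icc.1 (hsub h)
    omega
  simp [zapF, hj, trivT]

theorem zapF_of_mem {p : ℕ} (hp : p ∈ F) (s : TState) : zapF F s p = 0 := if_pos hp

theorem zapF_trivT_succ_eq_zero (s : TState) {j : ℕ} (h1 : 1 ≤ j) (h2 : j < 93) (h : s j = 0) :
    zapF F (trivT s) (j + 1) = 0 := by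
  have : trivT s (j + 1) = 0 := by
    simp only [trivT]
    rw [if_neg (by omega), if_pos (by omega), Nat.add_sub_cancel, h]
  simp [zapF, this]

variable {u : ℕ → TState}

theorem orbit_shift (hsub : F ⊆ Finset.Icc 1 93) {t₀ : ℕ}
    (hu : ∀ t, t₀ ≤ t → u (t + 1) = zapF F (trivT (u t)))
    {t j : ℕ} (ht : t₀ ≤ t) (h1 : 94 ≤ j) (i : ℕ) (h2 : j + i ≤ 288)
    (h3 : j + i ≤ 177 ∨ 178 ≤ j) : u (t + i) (j + i) = u t j := by
  induction i with
  | zero => rfl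
  | succ i ih =>
    rw [← add_assoc, ← add_assoc, hu _ (by omega),
      zapF_trivT_shift hsub _ (by omega) (by omega) (by omega)]
    exact ih (by omega) (by omega)

/-- The zero forced at a faulted position `p` propagates along the first register. -/
theorem orbit_eq_zero {p : ℕ} (hp : p ∈ F) (hp1 : 1 ≤ p) {t₀ : ℕ}
    (hu : ∀ t, t₀ ≤ t → u (t + 1) = zapF F (trivT (u t))) (h0 : u t₀ p = 0) (i : ℕ)
    (hi : p + i ≤ 93) {t : ℕ} (ht : t₀ + i ≤ t) : u t (p + i) = 0 := by
  induction i generalizing t with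
  | zero =>
    obtain rfl | ht' := Nat.eq_or_lt_of_le ht
    · exact h0
    · obtain ⟨r, rfl⟩ : ∃ r, t = r + 1 := ⟨t - 1, by omega⟩
      rw [hu _ (by omega)]
      exact zapF_of_mem hp _
  | succ i ih =>
    obtain ⟨r, rfl⟩ : ∃ r, t = r + 1 := ⟨t - 1, by omega⟩
    rw [hu _ (by omega), ← add_assoc]
    exact zapF_trivT_succ_eq_zero _ (by omega) (by omega) (ih (by omega) (by omega))

end FaultedOrbit

theorem traj_succ (F : Finset ℕ) (k : TState) (t : ℕ) :
    traj F k (t + 1) = zapF F (trivT (traj F k t)) := rfl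

theorem sHat_succ (F : Finset ℕ) (k : TState) (t : ℕ) (ht : 98 ≤ t) :
    sHat F k (t + 1) = zapF F (trivT (sHat F k t)) := by
  rw [sHat, Nat.sub_add_comm ht, Function.iterate_succ_apply', sHat]

theorem sHat_98 (F : Finset ℕ) (k : TState) : sHat F k 98 = sHatBase F k := rfl

section EarlyFault

variable {F : Finset ℕ} {p : ℕ} (k : TState)

theorem traj_eq_zero (hp : p ∈ F) (hp1 : 1 ≤ p) {j t : ℕ} (hpj : p ≤ j) (hj : j ≤ 93)
    (ht : 92 ≤ t) : traj F k t j = 0 := by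
  obtain ⟨i, rfl⟩ := Nat.exists_eq_add_of_le hpj
  exact orbit_eq_zero (t₀ := 0) hp hp1 (fun t _ => traj_succ F k t) (zapF_of_mem hp _) i hj
    (by omega)

theorem traj_succ_94 (hsub : F ⊆ Finset.Icc 1 93) (hp : p ∈ F) (hp1 : 1 ≤ p) (hp2 : p ≤ 66)
    {t : ℕ} (ht : 92 ≤ t) : traj F k (t + 1) 94 = traj F k t 171 := by
  rw [traj_succ, zapF_trivT_94 hsub, traj_eq_zero k hp hp1 (by omega) (by omega) ht,
    traj_eq_zero k hp hp1 (j := 91) (by omega) (by omega) ht,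
    traj_eq_zero k hp hp1 (j := 93) (by omega) (by omega) ht]
  ring

theorem traj_shift (hsub : F ⊆ Finset.Icc 1 93) {t j : ℕ} (h1 : 94 ≤ j) (i : ℕ)
    (h2 : j + i ≤ 177) : traj F k (t + i) (j + i) = traj F k t j :=
  orbit_shift (t₀ := 0) hsub (fun t _ => traj_succ F k t) (Nat.zero_le _) h1 i (by omega)
    (Or.inl h2)

theorem traj_add_78 (hsub : F ⊆ Finset.Icc 1 93) (hp : p ∈ F) (hp1 : 1 ≤ p) (hp2 : p ≤ 66)
    {t j : ℕ} (ht : 98 ≤ t) (h1 : 94 ≤ j) (h2 : j ≤ 177) :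
    traj F k (t + 78) j = traj F k t j := by
  obtain ⟨i, rfl⟩ := Nat.exists_eq_add_of_le h1
  obtain ⟨n, rfl⟩ : ∃ n, t = n + 1 + i := ⟨t - 1 - i, by omega⟩
  rw [traj_shift k hsub le_rfl i h2, show n + 1 + i + 78 = n + 78 + 1 + i by omega,
    traj_shift k hsub le_rfl i h2, traj_succ_94 k hsub hp hp1 hp2 (by omega)]
  exact traj_shift k hsub (t := n + 1) (j := 94) le_rfl 77 (by omega)

theorem bAt_add_78 (hsub : F ⊆ Finset.Icc 1 93) (hp : p ∈ F) (hp1 : 1 ≤ p) (hp2 : p ≤ 66)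
    {n : ℕ} (hn : 99 ≤ n) : bAt F k (n + 78) = bAt F k n := by
  simp only [bAt, Nat.sub_add_comm (show 1 ≤ n by omega)]
  have h {j : ℕ} (h1 : 94 ≤ j) (h2 : j ≤ 177) :=
    traj_add_78 k hsub hp hp1 hp2 (t := n - 1) (by omega) h1 h2
  rw [h, h, h, h] <;> norm_num

theorem bFun_add_78 (hsub : F ⊆ Finset.Icc 1 93) (hp : p ∈ F) (hp1 : 1 ≤ p) (hp2 : p ≤ 66) :
    Function.Periodic (bFun F k) 78 := by
  intro i
  by_cases hi : 99 ≤ i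
  · rw [bFun, bFun, if_pos hi, if_pos (by omega), ← bAt_add_78 k hsub hp hp1 hp2 (n := i.toNat) (by omega)]
    congr 1
    omega
  · have hmod (x : ℤ) : x.emod 78 = x % 78 := rfl
    by_cases hi' : 99 ≤ i + 78
    · rw [bFun, bFun, if_pos hi', if_neg hi, hmod]
      congr 1
      omega
    · rw [bFun, bFun, if_neg hi', if_neg hi, hmod, hmod]
      congr 1
      omega

theorem sHat_eq_zero (hp : p ∈ F) (hp1 : 1 ≤ p) {j t : ℕ} (hpj : p ≤ j) (hj : j ≤ 93)
    (ht : 98 ≤ t) : sHat F k t j = 0 := by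
  induction t, ht using Nat.le_induction generalizing j with
  | base =>
    rw [sHat_98, sHatBase, if_neg (by omega)]
    exact traj_eq_zero k hp hp1 hpj hj (by omega)
  | succ t ht ih =>
    rw [sHat_succ F k t ht]
    obtain rfl | hlt := Nat.eq_or_lt_of_le hpj
    · exact zapF_of_mem hp _
    · obtain ⟨i, rfl⟩ : ∃ i, j = i + 1 := ⟨j - 1, by omega⟩
      exact zapF_trivT_succ_eq_zero _ (by omega) (by omega) (ih (by omega) (by omega))

theorem sHat_eq_traj (hsub : F ⊆ Finset.Icc 1 93) (hp : p ∈ F) (hp1 : 1 ≤ p) (hp2 : p ≤ 66)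
    {j t : ℕ} (h1 : 94 ≤ j) (h2 : j ≤ 177) (ht : 98 ≤ t) : sHat F k t j = traj F k t j := by
  induction t, ht using Nat.le_induction generalizing j with
  | base => rw [sHat_98, sHatBase, if_neg (by omega)]
  | succ t ht ih =>
    obtain rfl | hlt := Nat.eq_or_lt_of_le h1
    · rw [traj_succ_94 k hsub hp hp1 hp2 (by omega), sHat_succ F k t ht, zapF_trivT_94 hsub,
        sHat_eq_zero k hp hp1 (j := 66) (by omega) (by omega) ht,
        sHat_eq_zero k hp hp1 (j := 91) (by omega) (by omega) ht,
        sHat_eq_zero k hp hp1 (j := 93) (by omega) (by omega) ht,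
        ih (j := 171) (by omega) (by omega)]
      ring
    · obtain ⟨i, rfl⟩ : ∃ i, j = i + 1 := ⟨j - 1, by omega⟩
      rw [sHat_succ F k t ht, traj_succ, zapF_trivT_shift hsub _ (by omega) (by omega) (by omega),
        zapF_trivT_shift hsub _ (by omega) (by omega) (by omega), ih (by omega) (by omega)]

theorem sHat_shift (hsub : F ⊆ Finset.Icc 1 93) {t t' j j' : ℕ} (ht : 98 ≤ t) (h1 : 178 ≤ j)
    (htt : t ≤ t') (h2 : j' ≤ 288) (h : t' + j = t + j') : sHat F k t' j' = sHat F k t j := by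
  obtain ⟨i, rfl⟩ := Nat.exists_eq_add_of_le htt
  obtain rfl : j' = j + i := by omega
  exact orbit_shift hsub (sHat_succ F k) ht (by omega) i h2 (Or.inr h1)

/-- The third register of the changed trajectory satisfies its feedback recursion with no
transient. -/
theorem sHat_add_87 (hsub : F ⊆ Finset.Icc 1 93) (hp : p ∈ F) (hp1 : 1 ≤ p) (hp2 : p ≤ 66)
    {j t : ℕ} (h1 : 178 ≤ j) (h2 : j ≤ 288) (ht : 98 ≤ t) :
    sHat F k (t + 87) j = sHat F k t j + bFun F k ((t : ℤ) - j + 265) := by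
  by_cases hn : j ≤ t + 166
  · obtain ⟨r, hr⟩ : ∃ r, r + j = t + 264 := ⟨t + 264 - j, by omega⟩
    have hr' : 98 ≤ r := by omega
    rw [sHat_shift k hsub (t := r + 1) (j := 178) (by omega) le_rfl (by omega) h2 (by omega),
      sHat_succ F k r hr', zapF_trivT_178 hsub]
    have h264 : sHat F k r 264 = sHat F k t j := by
      rcases le_total r t with h | h
      · exact (sHat_shift k hsub hr' (by omega) h h2 (by omega)).symm
      · exact sHat_shift k hsub ht h1 h (by omega) (by omega)
    have hb : bFun F k ((t : ℤ) - j + 265) = bAt F k (r + 1) := by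
      rw [bFun, if_pos (by omega)]
      congr 1
      omega
    have e {i : ℕ} (h1 : 94 ≤ i) (h2 : i ≤ 177) := sHat_eq_traj k hsub hp hp1 hp2 h1 h2 hr'
    rw [h264, hb, bAt, Nat.add_sub_cancel, e (i := 162), e (i := 175), e (i := 176),
      e (i := 177)] <;> first | ring1 | norm_num
  · obtain ⟨r, hr⟩ : ∃ r, r + t = 98 + j := ⟨98 + j - t, by omega⟩
    rw [sHat_shift k hsub (t := 98) (j := r - 87) le_rfl (by omega) (by omega) h2 (by omega),
      sHat_shift k hsub (t := 98) (j := r) le_rfl (by omega) ht h2 (by omega), sHat_98,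
      sHatBase, sHatBase, if_neg (by omega), if_pos (by omega), add_assoc,
      show (363 - (r : ℤ)) = (t : ℤ) - j + 265 by omega, CharTwo.add_self_eq_zero, add_zero]

theorem sHat_add_87_mul (hsub : F ⊆ Finset.Icc 1 93) (hp : p ∈ F) (hp1 : 1 ≤ p) (hp2 : p ≤ 66)
    {j t : ℕ} (h1 : 178 ≤ j) (h2 : j ≤ 288) (ht : 98 ≤ t) (n : ℕ) :
    sHat F k (t + 87 * n) j =
      sHat F k t j + ∑ m ∈ Finset.range n, bFun F k ((t : ℤ) - j + 265 + 87 * m) := by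
  induction n with
  | zero => simp
  | succ n ih =>
    rw [mul_add, mul_one, ← add_assoc, sHat_add_87 k hsub hp hp1 hp2 h1 h2 (by omega), ih,
      Finset.sum_range_succ, add_assoc]
    congr 3
    push_cast
    ring

end EarlyFault

/-- Steps of `87` and of `3` visit the same residues modulo `78`. -/
theorem sum_range_step_87_eq_step_3 {M : Type*} [AddCommMonoid M] {f : ℤ → M}
    (hf : Function.Periodic f 78) (x : ℤ) :
    ∑ m ∈ Finset.range 26, f (x + 87 * m) = ∑ m ∈ Finset.range 26, f (x + 3 * m) := by
  refine Finset.sum_nbij' (fun m => 3 * m % 26) (fun m => 9 * m % 26) ?_ ?_ ?_ ?_ ?_ <;>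
    simp only [Finset.mem_range] <;> intro m hm
  · omega
  · omega
  · omega
  · omega
  · have h := hf.int_mul ((m : ℤ) + 3 * m / 26) (x + 3 * ((3 * m % 26 : ℕ) : ℤ))
    rw [← h]
    congr 1
    push_cast
    omega

/-- Lemma 13 (Case 3). -/
theorem case3_period4524 (k : TState) (F : Finset ℕ) (hF : F.Nonempty)
    (hsub : F ⊆ Finset.Icc 1 93)
    (hlo : 1 ≤ F.min' hF) (hhi : F.min' hF ≤ 66) :
    (∀ t, 98 ≤ t → ∀ j, 178 ≤ j → j ≤ 288 →
        sHat F k (t + 2262) j =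
          sHat F k t j +
            ∑ m ∈ Finset.range 26, bFun F k ((t : ℤ) + 31 - (j : ℤ) + 3 * (m : ℤ))) ∧
    (∀ t, 98 ≤ t → ∀ j, 94 ≤ j → j ≤ 288 → sHat F k (t + 4524) j = sHat F k t j) := by
  have hp := F.min'_mem hF
  have hper := bFun_add_78 k hsub hp hlo hhi
  have hthird : ∀ t, 98 ≤ t → ∀ j, 178 ≤ j → j ≤ 288 →
      sHat F k (t + 2262) j = sHat F k t j +
        ∑ m ∈ Finset.range 26, bFun F k ((t : ℤ) + 31 - (j : ℤ) + 3 * (m : ℤ)) := by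
    intro t ht j h1 h2
    rw [show 2262 = 87 * 26 by norm_num, sHat_add_87_mul k hsub hp hlo hhi h1 h2 ht,
      sum_range_step_87_eq_step_3 hper]
    refine congrArg (sHat F k t j + ·) (Finset.sum_congr rfl fun m _ => ?_)
    rw [← hper.int_mul 3 ((t : ℤ) + 31 - j + 3 * m)]
    congr 1
    push_cast
    ring
  refine ⟨hthird, fun t ht j h1 h2 => ?_⟩
  by_cases hj : 178 ≤ j
  · rw [show t + 4524 = t + 2262 + 2262 by ring, hthird _ (by omega) j hj h2,
      hthird t ht j hj h2, add_assoc,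
      ← Finset.sum_add_distrib, Finset.sum_eq_zero, add_zero]
    intro m _
    rw [← hper.int_mul 29 ((t : ℤ) + 31 - j + 3 * m), show ((t + 2262 : ℕ) : ℤ) + 31 - j + 3 * m =
      (t : ℤ) + 31 - j + 3 * m + (29 : ℤ) * 78 by push_cast; ring]
    exact CharTwo.add_self_eq_zero _
  · have key (n : ℕ) : traj F k (t + 78 * n) j = traj F k t j := by
      induction n with
      | zero => rfl
      | succ n ih =>
        rw [mul_add, mul_one, ← add_assoc,
          traj_add_78 k hsub hp hlo hhi (by omega) h1 (by omega), ih]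
    rw [sHat_eq_traj k hsub hp hlo hhi h1 (by omega) (by omega),
      sHat_eq_traj k hsub hp hlo hhi h1 (by omega) ht]
    exact key 58
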